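/- Prescribing derivatives of a fixed function along trajectories of a constructed vector field (core of the genericity theorem for vector fields X): let n ≥ 1, let F : ℝⁿ → ℝ be C^∞, let z ∈ ℝⁿ with fderiv ℝ F z ≠ 0, and let x₀ ∈ ℝⁿ with x₀ ≠ 0. Then for every m ≥ 2 and every prescribed values v₂, …, v_m ∈ ℝ, there exists a C^∞ vector field X : ℝⁿ → ℝⁿ with X(z) = x₀ such that every integral curve γ of X on a neighbourhood of 0 with γ(0) = z satisfies deriv^[k] (F ∘ γ) 0 = v_k for all k with 2 ≤ k ≤ m. -/

import Mathlib

/-- Lie derivative of `F` along `X`. -/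
noncomputable def lieD {n : ℕ} (X : (Fin n → ℝ) → (Fin n → ℝ)) (F : (Fin n → ℝ) → ℝ) :
    (Fin n → ℝ) → ℝ := fun x => fderiv ℝ F x (X x)

theorem lieD_smooth {n : ℕ} {X : (Fin n → ℝ) → (Fin n → ℝ)} {F : (Fin n → ℝ) → ℝ}
    (hX : ContDiff ℝ (⊤ : ℕ∞) X) (hF : ContDiff ℝ (⊤ : ℕ∞) F) :
    ContDiff ℝ (⊤ : ℕ∞) (lieD X F) :=
  (hF.fderiv_right (m := ((⊤ : ℕ∞) : WithTop ℕ∞)) le_rfl).clm_apply hX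

theorem lieD_iter_smooth {n : ℕ} {X : (Fin n → ℝ) → (Fin n → ℝ)} {F : (Fin n → ℝ) → ℝ}
    (hX : ContDiff ℝ (⊤ : ℕ∞) X) (hF : ContDiff ℝ (⊤ : ℕ∞) F) (k : ℕ) :
    ContDiff ℝ (⊤ : ℕ∞) ((lieD X)^[k] F) := by
  induction k with
  | zero => simpa using hF
  | succ k ih => rw [Function.iterate_succ_apply']; exact lieD_smooth hX ih

theorem deriv_iter_eq {n : ℕ} {X : (Fin n → ℝ) → (Fin n → ℝ)} {F : (Fin n → ℝ) → ℝ}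
    (hX : ContDiff ℝ (⊤ : ℕ∞) X) (hF : ContDiff ℝ (⊤ : ℕ∞) F) (γ : ℝ → (Fin n → ℝ))
    (hγ : ∀ᶠ t in nhds (0 : ℝ), HasDerivAt γ (X (γ t)) t) (k : ℕ) :
    ∀ᶠ t in nhds (0 : ℝ), deriv^[k] (F ∘ γ) t = (lieD X)^[k] F (γ t) := by
  induction k with
  | zero => simp
  | succ k ih =>
    filter_upwards [ih.eventually_nhds, hγ] with t h1 h2
    rw [Function.iterate_succ_apply', Function.iterate_succ_apply']
    have h3 : deriv^[k] (F ∘ γ) =ᶠ[nhds t] fun s => (lieD X)^[k] F (γ s) := h1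
    rw [h3.deriv_eq]
    have hd := ((lieD_iter_smooth hX hF k).differentiable (by simp)) (γ t)
    exact (hd.hasFDerivAt.comp_hasDerivAt t h2).deriv

theorem lieD_perturb {n : ℕ} {X : (Fin n → ℝ) → (Fin n → ℝ)} {F : (Fin n → ℝ) → ℝ}
    (hX : ContDiff ℝ (⊤ : ℕ∞) X) (hF : ContDiff ℝ (⊤ : ℕ∞) F)
    (z w : Fin n → ℝ) (l : (Fin n → ℝ) →L[ℝ] ℝ) (hl : l (X z) = 1) (a : ℝ) (r : ℕ) (hr : 1 ≤ r)
    (Y : (Fin n → ℝ) → (Fin n → ℝ)) (hY : Y = fun x => X x + (a * l (x - z) ^ r) • w) (j : ℕ) :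
    j ≤ r → ∃ G : (Fin n → ℝ) → ℝ, ContDiff ℝ (⊤ : ℕ∞) G ∧
      G z = a * (r.descFactorial j : ℝ) * fderiv ℝ F z w ∧
      (lieD Y)^[j + 1] F = fun x => (lieD X)^[j + 1] F x + l (x - z) ^ (r - j) * G x := by
  have hu : ContDiff ℝ (⊤ : ℕ∞) (fun x => l (x - z)) := l.contDiff.comp (contDiff_id.sub contDiff_const)
  have hYs : ContDiff ℝ (⊤ : ℕ∞) Y := by
    rw [hY]; exact hX.add ((contDiff_const.mul (hu.pow r)).smul contDiff_const)
  have hYz : l (Y z) = 1 := by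
    simp [hY, hl, show r ≠ 0 by omega]
  have hdir : ∀ H : (Fin n → ℝ) → ℝ, ContDiff ℝ (⊤ : ℕ∞) H →
      ContDiff ℝ (⊤ : ℕ∞) (fun x => fderiv ℝ H x w) := fun H hH =>
    (hH.fderiv_right (m := ((⊤ : ℕ∞) : WithTop ℕ∞)) le_rfl).clm_apply contDiff_const
  induction j with
  | zero =>
    intro _
    refine ⟨fun x => a * fderiv ℝ F x w, contDiff_const.mul (hdir F hF), by simp, ?_⟩
    funext x
    simp [lieD, hY]
    ring
  | succ j ih =>
    intro hj
    obtain ⟨G, hG, hGz, hGe⟩ := ih (by omega)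
    have hP := lieD_iter_smooth hX hF (j + 1)
    refine ⟨fun x => a * l (x - z) ^ (j + 1) * fderiv ℝ ((lieD X)^[j + 1] F) x w
      + l (x - z) * lieD Y G x + ((r - j : ℕ) : ℝ) * l (Y x) * G x, ?_, ?_, ?_⟩
    · exact (((contDiff_const.mul (hu.pow _)).mul (hdir _ hP)).add
        (hu.mul (lieD_smooth hYs hG))).add ((contDiff_const.mul (l.contDiff.comp hYs)).mul hG)
    · simp [hYz, hGz, Nat.descFactorial_succ]
      ring
    · rw [Function.iterate_succ_apply' (lieD Y), Function.iterate_succ_apply' (lieD X), hGe]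
      funext x
      have d1 := ((hP.differentiable (by simp)) x).hasFDerivAt
      have d2 := ((hG.differentiable (by simp)) x).hasFDerivAt
      have d3 : HasFDerivAt (fun x => l (x - z)) l x :=
        l.hasFDerivAt.comp x ((hasFDerivAt_id x).sub_const z)
      have d4 := (d1.add ((d3.pow (r - j)).mul d2)).fderiv
      obtain ⟨q, hq⟩ : ∃ q, r = j + 1 + q := ⟨r - (j + 1), by omega⟩
      have e1 : r - j = q + 1 := by omega
      have e2 : r - (j + 1) = q := by omega
      have d5 : lieD Y (fun x => (lieD X)^[j + 1] F x + l (x - z) ^ (r - j) * G x) x = _ :=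
        congrArg (fun A => A (Y x)) d4
      rw [d5]
      have hYx : fderiv ℝ ((lieD X)^[j + 1] F) x (Y x) = lieD X ((lieD X)^[j + 1] F) x
          + a * l (x - z) ^ r * fderiv ℝ ((lieD X)^[j + 1] F) x w := by
        simp only [lieD, hY, map_add, map_smul, smul_eq_mul]
      have hGx : fderiv ℝ G x (Y x) = lieD Y G x := rfl
      simp only [add_apply, ContinuousLinearMap.add_apply, ContinuousLinearMap.smul_apply, smul_eq_mul, hYx, hGx, e1, e2]
      rw [hq]
      simp
      ring

theorem exists_X_lieD {n : ℕ} (F : (Fin n → ℝ) → ℝ) (hF : ContDiff ℝ (⊤ : ℕ∞) F)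
    (z : Fin n → ℝ) (hdF : fderiv ℝ F z ≠ 0)
    (x₀ : Fin n → ℝ) (hx₀ : x₀ ≠ 0) (v : ℕ → ℝ) (m : ℕ) :
    ∃ X : (Fin n → ℝ) → (Fin n → ℝ), ContDiff ℝ (⊤ : ℕ∞) X ∧ X z = x₀ ∧
      ∀ k, 2 ≤ k → k ≤ m → (lieD X)^[k] F z = v k := by
  obtain ⟨l, hl⟩ := SeparatingDual.exists_eq_one (R := ℝ) hx₀
  obtain ⟨w, hw⟩ : ∃ w, fderiv ℝ F z w ≠ 0 := by
    by_contra! h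
    exact hdF (ContinuousLinearMap.ext h)
  induction m with
  | zero => exact ⟨fun _ => x₀, contDiff_const, rfl, fun k h1 h2 => by omega⟩
  | succ r ih =>
    obtain ⟨X, hX, hXz, hXk⟩ := ih
    rcases Nat.eq_zero_or_pos r with h0 | hr
    · exact ⟨X, hX, hXz, fun k h1 h2 => by omega⟩
    have hc : (r.descFactorial r : ℝ) * fderiv ℝ F z w ≠ 0 := by
      refine mul_ne_zero ?_ hw
      rw [Nat.descFactorial_self]
      exact_mod_cast r.factorial_ne_zero
    set a : ℝ := (v (r + 1) - (lieD X)^[r + 1] F z) / ((r.descFactorial r : ℝ) * fderiv ℝ F z w)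
      with ha
    have hu : ContDiff ℝ (⊤ : ℕ∞) (fun x => l (x - z)) :=
      l.contDiff.comp (contDiff_id.sub contDiff_const)
    refine ⟨fun x => X x + (a * l (x - z) ^ r) • w,
      hX.add ((contDiff_const.mul (hu.pow r)).smul contDiff_const), ?_, ?_⟩
    · simp [hXz, show r ≠ 0 by omega]
    · intro k h1 h2
      obtain ⟨j, rfl⟩ : ∃ j, k = j + 1 := ⟨k - 1, by omega⟩
      obtain ⟨G, -, hGz, hGe⟩ := lieD_perturb hX hF z w l (by rw [hXz, hl]) a r hr _ rfl j
        (by omega)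
      rw [hGe]
      rcases Nat.lt_or_ge j r with hj | hj
      · have : r - j ≠ 0 := by omega
        simp only [sub_self, map_zero, zero_pow this, zero_mul, add_zero]
        exact hXk _ h1 hj
      · obtain rfl : j = r := by omega
        simp only [Nat.sub_self, pow_zero, one_mul, hGz]
        rw [mul_assoc, ha, div_mul_cancel₀ _ hc]
        ring

/-- **Prescribing derivatives of a fixed function along trajectories of a constructed
vector field** (core of the genericity theorem for vector fields `X`): if `F` is smooth
with `fderiv ℝ F z ≠ 0` and `x₀ ≠ 0`, then for every `m ≥ 2` and prescribed values
`v 2, …, v m`, there is a smooth vector field `X` with `X z = x₀` such that every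
integral curve `γ` of `X` near `0` with `γ 0 = z` satisfies
`deriv^[k] (F ∘ γ) 0 = v k` for all `2 ≤ k ≤ m`. -/
theorem exists_smooth_X_with_prescribed_derivs_of_F_along_trajectories
    {n : ℕ} (hn : 1 ≤ n)
    (F : (Fin n → ℝ) → ℝ) (hF : ContDiff ℝ (⊤ : ℕ∞) F)
    (z : Fin n → ℝ) (hdF : fderiv ℝ F z ≠ 0)
    (x₀ : Fin n → ℝ) (hx₀ : x₀ ≠ 0)
    (m : ℕ) (hm : 2 ≤ m) (v : ℕ → ℝ) :
    ∃ X : (Fin n → ℝ) → (Fin n → ℝ), ContDiff ℝ (⊤ : ℕ∞) X ∧ X z = x₀ ∧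
      ∀ γ : ℝ → (Fin n → ℝ),
        (∀ᶠ t in nhds (0 : ℝ), HasDerivAt γ (X (γ t)) t) → γ 0 = z →
        ∀ k, 2 ≤ k → k ≤ m → deriv^[k] (F ∘ γ) 0 = v k := by
  obtain ⟨X, hX, hXz, hXk⟩ := exists_X_lieD F hF z hdF x₀ hx₀ v m
  refine ⟨X, hX, hXz, fun γ hγ h0 k h1 h2 => ?_⟩
  rw [(deriv_iter_eq hX hF γ hγ k).self_of_nhds, h0]
  exact hXk k h1 h2
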